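/- Let A₆ = ℚ[h₄,h₆,h₁₂]/(h₁₂² + 3h₆⁴ + h₄⁶) and let σ be the ℚ-algebra involution of A₆ determined by σ(h₄) = h₄, σ(h₆) = −h₆, σ(h₁₂) = −h₁₂. Then the ℚ-algebra homomorphism ℚ[x,y,z] → A₆ given by x ↦ h₄, y ↦ h₆², z ↦ h₆h₁₂ sends z² + 3y³ + x⁶y to 0 and induces a ℚ-algebra isomorphism ℚ[x,y,z]/(z² + 3y³ + x⁶y) ≅ A₆^σ, where A₆^σ is the subalgebra of σ-fixed elements of A₆. -/

import Mathlib

open MvPolynomial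

/-- The canonical ring `A₆ = ℚ[h₄,h₆,h₁₂]/(h₁₂² + 3h₆⁴ + h₄⁶)` of the Shimura curve of
discriminant 6; the variables `X 0, X 1, X 2` play the roles of `h₄, h₆, h₁₂`. -/
noncomputable abbrev A6 : Type :=
  MvPolynomial (Fin 3) ℚ ⧸
    Ideal.span {(X 2 : MvPolynomial (Fin 3) ℚ) ^ 2 + 3 * X 1 ^ 4 + X 0 ^ 6}

/-- The class of `h₄` in `A₆`. -/
noncomputable def h4 : A6 := Ideal.Quotient.mk _ (X 0)

/-- The class of `h₆` in `A₆`. -/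
noncomputable def h6 : A6 := Ideal.Quotient.mk _ (X 1)

/-- The class of `h₁₂` in `A₆`. -/
noncomputable def h12 : A6 := Ideal.Quotient.mk _ (X 2)

/-- The map `ℚ[x, y, z] → A₆`, `x ↦ h₄`, `y ↦ h₆²`, `z ↦ h₆h₁₂`. -/
noncomputable abbrev evenMap : MvPolynomial (Fin 3) ℚ →ₐ[ℚ] A6 :=
  aeval (![h4, h6 ^ 2, h6 * h12] : Fin 3 → A6)

lemma h12_sq : h12 ^ 2 = -(3 * h6 ^ 4 + h4 ^ 6) := by
  have h : h12 ^ 2 + 3 * h6 ^ 4 + h4 ^ 6 = 0 :=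
    Ideal.Quotient.eq_zero_iff_mem.mpr (Ideal.mem_span_singleton_self _)
  linear_combination h

lemma evenMap_relation :
    evenMap ((X 2 : MvPolynomial (Fin 3) ℚ) ^ 2 + 3 * X 1 ^ 3 + X 0 ^ 6 * X 1) = 0 := by
  simp only [map_add, map_mul, map_pow, map_ofNat, aeval_X, Matrix.cons_val]
  linear_combination h6 ^ 2 * h12_sq

/-- `A₆` is generated by `1, h₆, h₁₂` as a module over the image of `evenMap`. -/
lemma exists_evenMap_decomposition (a : A6) : ∃ p q r : MvPolynomial (Fin 3) ℚ,
    a = evenMap p + h6 * evenMap q + h12 * evenMap r := by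
  obtain ⟨a, rfl⟩ := Ideal.Quotient.mk_surjective a
  induction a using MvPolynomial.induction_on with
  | C c => exact ⟨C c, 0, 0, by simp [evenMap]; rfl⟩
  | add a b ha hb =>
    obtain ⟨p, q, r, h⟩ := ha
    obtain ⟨p', q', r', h'⟩ := hb
    refine ⟨p + p', q + q', r + r', ?_⟩
    simp only [map_add]
    linear_combination h + h'
  | mul_X a i h =>
    obtain ⟨p, q, r, h⟩ := h
    rw [map_mul, h]
    fin_cases i
    · refine ⟨p * X 0, q * X 0, r * X 0, ?_⟩
      change _ * h4 = _
      simp only [map_mul, aeval_X, Matrix.cons_val]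
      ring
    · refine ⟨q * X 1 + r * X 2, p, 0, ?_⟩
      change _ * h6 = _
      simp only [map_add, map_mul, map_zero, aeval_X, Matrix.cons_val]
      ring
    · refine ⟨q * X 2 - r * (3 * X 1 ^ 2 + X 0 ^ 6), 0, p, ?_⟩
      change _ * h12 = _
      simp only [map_add, map_sub, map_mul, map_pow, map_ofNat, map_zero, aeval_X,
        Matrix.cons_val]
      linear_combination evenMap r * h12_sq

/-- Division with remainder by `z² + 3y³ + x⁶y`, as a polynomial in `z`. -/
lemma exists_remainder (q : MvPolynomial (Fin 3) ℚ) :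
    ∃ (a b : MvPolynomial (Fin 2) ℚ) (c : MvPolynomial (Fin 3) ℚ),
      q = rename Fin.castSucc a + rename Fin.castSucc b * X 2 +
        (X 2 ^ 2 + 3 * X 1 ^ 3 + X 0 ^ 6 * X 1) * c := by
  induction q using MvPolynomial.induction_on with
  | C c => exact ⟨C c, 0, 0, by simp⟩
  | add p q hp hq =>
    obtain ⟨a, b, c, h⟩ := hp
    obtain ⟨a', b', c', h'⟩ := hq
    refine ⟨a + a', b + b', c + c', ?_⟩
    simp only [map_add]
    linear_combination h + h'
  | mul_X p i h =>
    obtain ⟨a, b, c, h⟩ := h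
    rw [h]
    fin_cases i
    · refine ⟨a * X 0, b * X 0, c * X 0, ?_⟩
      simp only [map_mul, rename_X, Fin.castSucc_zero, Fin.zero_eta]
      ring
    · refine ⟨a * X 1, b * X 1, c * X 1, ?_⟩
      simp only [map_mul, rename_X, Fin.castSucc_one, Fin.mk_one]
      ring
    · refine ⟨-(b * (3 * X 1 ^ 3 + X 0 ^ 6 * X 1)), a,
        rename Fin.castSucc b + c * X 2, ?_⟩
      simp only [map_neg, map_add, map_mul, map_pow, map_ofNat, rename_X, Fin.castSucc_zero,
        Fin.castSucc_one, Fin.reduceFinMk]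
      ring

lemma aeval_X_zero_X_one_sq_injective : Function.Injective
    (aeval ![X 0, X 1 ^ 2] : MvPolynomial (Fin 2) ℚ →ₐ[ℚ] MvPolynomial (Fin 2) ℚ) := by
  have h : (aeval ![X 0 ^ 2, X 1] : MvPolynomial (Fin 2) ℚ →ₐ[ℚ] MvPolynomial (Fin 2) ℚ).comp
      (aeval ![X 0, X 1 ^ 2]) = expand 2 := by
    ext i : 1
    fin_cases i <;> simp
  have hinj : Function.Injective (expand 2 : MvPolynomial (Fin 2) ℚ →ₐ[ℚ] _) :=
    expand_injective two_pos
  rw [← h, AlgHom.coe_comp] at hinj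
  exact hinj.of_comp

lemma eq_zero_of_evenMap_eq_zero {a b : MvPolynomial (Fin 2) ℚ}
    (h : evenMap (rename Fin.castSucc a + rename Fin.castSucc b * X 2) = 0) :
    a = 0 ∧ b = 0 := by
  let θ : MvPolynomial (Fin 3) ℚ →ₐ[ℚ] MvPolynomial (Fin 3) ℚ :=
    aeval ![X 0, X 1 ^ 2, X 1 * X 2]
  let η : MvPolynomial (Fin 3) ℚ →ₐ[ℚ] Polynomial (MvPolynomial (Fin 2) ℚ) :=
    aeval ![Polynomial.C (X 0), Polynomial.C (X 1), Polynomial.X]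
  let ε : MvPolynomial (Fin 2) ℚ →ₐ[ℚ] MvPolynomial (Fin 2) ℚ := aeval ![X 0, X 1 ^ 2]
  have hθ : (Ideal.Quotient.mkₐ ℚ _).comp θ = evenMap := by
    ext i : 1
    fin_cases i <;> simp [θ, h4, h6, h12]
  have hη (p : MvPolynomial (Fin 2) ℚ) :
      η (θ (rename Fin.castSucc p)) = Polynomial.C (ε p) := by
    have : (η.comp θ).comp (rename Fin.castSucc) = Polynomial.CAlgHom.comp ε := by
      ext i : 1
      fin_cases i <;> simp [θ, η, ε]
    exact DFunLike.congr_fun this p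
  rw [← hθ] at h
  obtain ⟨c, hc⟩ := Ideal.mem_span_singleton.mp (Ideal.Quotient.eq_zero_iff_mem.mp h)
  have hdvd := congrArg η hc
  have hθX : η (θ (X 2)) = Polynomial.C (X 1) * Polynomial.X := by simp [θ, η]
  have hg : η (X 2 ^ 2 + 3 * X 1 ^ 4 + X 0 ^ 6) =
      Polynomial.X ^ 2 + Polynomial.C (3 * X 1 ^ 4 + X 0 ^ 6) := by
    simp [η, add_assoc, ← map_ofNat Polynomial.C]
  change η (θ _) = _ at hdvd
  rw [map_add, map_mul, map_add, map_mul, hη, hη, hθX, map_mul, hg, ← mul_assoc,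
    ← Polynomial.C_mul, add_comm] at hdvd
  have hzero : Polynomial.C (ε b * X 1) * Polynomial.X + Polynomial.C (ε a) = 0 :=
    by_contra fun hne =>
      (Polynomial.monic_X_pow_add_C (3 * X 1 ^ 4 + X 0 ^ 6) two_ne_zero).not_dvd_of_degree_lt hne
        (by
          rw [Polynomial.degree_X_pow_add_C two_pos]
          exact Polynomial.degree_linear_le.trans_lt (by norm_num)) ⟨_, hdvd⟩
  have ha : ε a = 0 := by simpa using congrArg (Polynomial.coeff · 0) hzero
  have hb : ε b = 0 := by simpa using congrArg (Polynomial.coeff · 1) hzero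
  exact ⟨aeval_X_zero_X_one_sq_injective (ha.trans (map_zero _).symm),
    aeval_X_zero_X_one_sq_injective (hb.trans (map_zero _).symm)⟩

lemma evenMap_eq_zero_iff (q : MvPolynomial (Fin 3) ℚ) :
    evenMap q = 0 ↔
      q ∈ Ideal.span {(X 2 : MvPolynomial (Fin 3) ℚ) ^ 2 + 3 * X 1 ^ 3 + X 0 ^ 6 * X 1} := by
  rw [Ideal.mem_span_singleton]
  constructor
  · intro h
    obtain ⟨a, b, c, rfl⟩ := exists_remainder q
    rw [map_add, map_mul _ _ c, evenMap_relation, zero_mul, add_zero] at h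
    obtain ⟨rfl, rfl⟩ := eq_zero_of_evenMap_eq_zero h
    simp
  · rintro ⟨c, rfl⟩
    rw [map_mul, evenMap_relation, zero_mul]

/-- if `σ` is the ℚ-algebra involution of `A₆` with `σ(h₄) = h₄`,
`σ(h₆) = −h₆`, `σ(h₁₂) = −h₁₂`, then the map `x ↦ h₄, y ↦ h₆², z ↦ h₆h₁₂` kills
`z² + 3y³ + x⁶y` and induces `ℚ[x,y,z]/(z² + 3y³ + x⁶y) ≅ A₆^σ`. -/
theorem stmt_12 (σ : A6 ≃ₐ[ℚ] A6)
    (hσ4 : σ h4 = h4) (hσ6 : σ h6 = -h6) (hσ12 : σ h12 = -h12) :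
    aeval (![h4, h6 ^ 2, h6 * h12] : Fin 3 → A6)
        ((X 2 : MvPolynomial (Fin 3) ℚ) ^ 2 + 3 * X 1 ^ 3 + X 0 ^ 6 * X 1) = 0 ∧
    ∃ ψ : (MvPolynomial (Fin 3) ℚ ⧸
            Ideal.span
              {(X 2 : MvPolynomial (Fin 3) ℚ) ^ 2 + 3 * X 1 ^ 3 + X 0 ^ 6 * X 1})
          ≃ₐ[ℚ] (AlgHom.equalizer (σ : A6 →ₐ[ℚ] A6) (AlgHom.id ℚ A6)),
      ∀ q : MvPolynomial (Fin 3) ℚ,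
        (ψ (Ideal.Quotient.mk _ q) : A6) =
          aeval (![h4, h6 ^ 2, h6 * h12] : Fin 3 → A6) q := by
  refine ⟨evenMap_relation, ?_⟩
  have hfix (q) : σ (evenMap q) = evenMap q := by
    have : (σ : A6 →ₐ[ℚ] A6).comp evenMap = evenMap := by
      ext i : 1
      fin_cases i <;> simp [hσ4, hσ6, hσ12] <;> ring
    exact DFunLike.congr_fun this q
  let φ : MvPolynomial (Fin 3) ℚ →ₐ[ℚ] AlgHom.equalizer (σ : A6 →ₐ[ℚ] A6) (AlgHom.id ℚ A6) :=
    evenMap.codRestrict _ hfix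
  have hφ (q) : φ q = 0 ↔ evenMap q = 0 := Subtype.ext_iff
  refine ⟨AlgEquiv.ofBijective (Ideal.Quotient.liftₐ _ φ fun q hq =>
    (hφ q).mpr ((evenMap_eq_zero_iff q).mpr hq)) ⟨?_, ?_⟩, fun q => rfl⟩
  · rw [injective_iff_map_eq_zero]
    intro q hq
    obtain ⟨q, rfl⟩ := Ideal.Quotient.mk_surjective q
    exact Ideal.Quotient.eq_zero_iff_mem.mpr ((evenMap_eq_zero_iff q).mp ((hφ q).mp hq))
  · rintro ⟨a, ha⟩
    obtain ⟨p, q, r, rfl⟩ := exists_evenMap_decomposition a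
    refine ⟨Ideal.Quotient.mk _ p, Subtype.ext ?_⟩
    change evenMap p = _
    have hσ : σ (evenMap p + h6 * evenMap q + h12 * evenMap r) =
      evenMap p + h6 * evenMap q + h12 * evenMap r := ha
    simp only [map_add, map_mul, hfix, hσ6, hσ12] at hσ
    have htwo : (2 : ℚ) • (h6 * evenMap q + h12 * evenMap r) = 0 := by
      rw [two_smul]
      linear_combination -hσ
    have hodd := (smul_eq_zero.mp htwo).resolve_left two_ne_zero
    linear_combination -hodd
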